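/- There is a constant c > 0 such that for every integer k ≥ 2, every integer t ≥ c·k²·log k, and every positive integer m, every coloring of {1, 2, …, tm} with t colors in which every color is used exactly m times contains a rainbow k-term arithmetic progression. In particular, T_k ≤ c·k²·log k. Here log denotes the natural logarithm. -/

import Mathlib

namespace RainbowAP

open Finset Real Chebyshev

lemma sum_log_primeFactors_le {n : ℕ} (hn : n ≠ 0) :
    ∑ p ∈ n.primeFactors, log p ≤ log n := by
  rw [← log_prod fun p hp => by
    exact_mod_cast (Nat.prime_of_mem_primeFactors hp).ne_zero]
  have h := Nat.le_of_dvd (Nat.pos_of_ne_zero hn) (Nat.prod_primeFactors_dvd n)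
  have hpos : 0 < ∏ p ∈ n.primeFactors, p :=
    prod_pos fun p hp => (Nat.prime_of_mem_primeFactors hp).pos
  rw [← Nat.cast_prod]
  exact log_le_log (by exact_mod_cast hpos) (by exact_mod_cast h)

lemma sum_log_primeFactors_of_squarefree {n : ℕ} (hn : Squarefree n) :
    ∑ p ∈ n.primeFactors, log p = log n := by
  rw [← log_prod fun p hp => by
    exact_mod_cast (Nat.prime_of_mem_primeFactors hp).ne_zero]
  rw [← Nat.cast_prod, Nat.prod_primeFactors_of_squarefree hn]

/-- An upper bound of Mertens type for `∑ log p / p`. -/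
lemma sum_log_div_prime_le {n : ℕ} (hn : n ≠ 0) :
    ∑ p ∈ n.primesLE, log p / p ≤ log n + log 4 := by
  have hn0 : (0 : ℝ) < n := by exact_mod_cast Nat.pos_of_ne_zero hn
  have key : ∑ p ∈ n.primesLE, ((n / p : ℕ) : ℝ) * log p ≤ n * log n := by
    calc ∑ p ∈ n.primesLE, ((n / p : ℕ) : ℝ) * log p
        = ∑ p ∈ n.primesLE, ∑ _j ∈ Ioc 0 n with p ∣ _j, log p := by
          refine sum_congr rfl fun p _ => ?_
          rw [sum_const, Nat.Ioc_filter_dvd_card_eq_div, nsmul_eq_mul]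
      _ = ∑ j ∈ Ioc 0 n, ∑ p ∈ j.primeFactors, log p := by
          refine sum_comm' fun p j => ?_
          simp only [Nat.mem_primesLE, mem_filter, mem_Ioc, Nat.mem_primeFactors]
          constructor
          · rintro ⟨⟨_, hp⟩, ⟨hj, hjn⟩, hd⟩
            exact ⟨⟨hp, hd, hj.ne'⟩, hj, hjn⟩
          · rintro ⟨⟨hp, hd, _⟩, hj, hjn⟩
            exact ⟨⟨(Nat.le_of_dvd hj hd).trans hjn, hp⟩, ⟨hj, hjn⟩, hd⟩
      _ ≤ ∑ _j ∈ Ioc 0 n, log n := by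
          refine sum_le_sum fun j hj => ?_
          rw [mem_Ioc] at hj
          exact (sum_log_primeFactors_le hj.1.ne').trans
            (log_le_log (by exact_mod_cast hj.1) (by exact_mod_cast hj.2))
      _ = n * log n := by simp
  have hθ : ∑ p ∈ n.primesLE, log (p : ℝ) ≤ log 4 * n := by
    rw [← theta_eq_sum_primesLE_log]
    exact theta_le_log4_mul_x hn0.le
  have h : n * ∑ p ∈ n.primesLE, log p / p ≤ n * (log n + log 4) := by
    calc n * ∑ p ∈ n.primesLE, log p / p
        ≤ ∑ p ∈ n.primesLE, (((n / p : ℕ) : ℝ) * log p + log p) := by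
          rw [mul_sum]
          refine sum_le_sum fun p hp => ?_
          have hp1 := Nat.one_lt_of_mem_primesLE hp
          have hlog : 0 ≤ log (p : ℝ) := log_natCast_nonneg p
          have hfl : (n : ℝ) / p ≤ ((n / p : ℕ) : ℝ) + 1 := by
            rw [← Nat.floor_div_eq_div (K := ℝ)]
            exact (Nat.lt_floor_add_one _).le
          calc (n : ℝ) * (log p / p) = n / p * log p := by ring
            _ ≤ (((n / p : ℕ) : ℝ) + 1) * log p := by gcongr
            _ = _ := by ring
      _ ≤ _ := by
          rw [sum_add_distrib]
          linarith
  exact le_of_mul_le_mul_left h hn0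

lemma log_four_le {k : ℕ} (hk : 2 ≤ k) : log 4 ≤ 2 * log k := by
  have : log (4 : ℝ) = 2 * log 2 := by
    rw [show (4 : ℝ) = 2 ^ 2 by norm_num, log_pow]; norm_num
  have := log_le_log (by norm_num : (0 : ℝ) < 2) (by exact_mod_cast hk : (2 : ℝ) ≤ k)
  linarith

lemma half_lt_log {k : ℕ} (hk : 2 ≤ k) : 1 / 2 < log (k : ℝ) := by
  have := log_le_log (by norm_num : (0 : ℝ) < 2) (by exact_mod_cast hk : (2 : ℝ) ≤ k)
  linarith [log_two_gt_d9]

lemma sum_inv_Icc_le (n : ℕ) : ∑ i ∈ Icc 1 n, (i : ℝ)⁻¹ ≤ 1 + log n := by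
  have := harmonic_le_one_add_log n
  rw [harmonic_eq_sum_Icc] at this
  push_cast at this
  exact this

lemma log_add_one_le_sum_inv_Icc (n : ℕ) : log (n + 1) ≤ ∑ i ∈ Icc 1 n, (i : ℝ)⁻¹ := by
  have := log_add_one_le_harmonic n
  rw [harmonic_eq_sum_Icc] at this
  push_cast at this
  exact this

lemma sum_inv_sq_Icc_le (n : ℕ) : ∑ i ∈ Icc 1 n, ((i : ℝ) ^ 2)⁻¹ ≤ 2 := by
  rcases Nat.eq_zero_or_pos n with rfl | hn
  · simp
  have : ∑ i ∈ Icc 1 n, ((i : ℝ) ^ 2)⁻¹ ≤ 2 - (n : ℝ)⁻¹ := by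
    induction n, hn using Nat.le_induction with
    | base => norm_num
    | succ n hn ih =>
      rw [sum_Icc_succ_top (by omega)]
      have hn0 : (0 : ℝ) < n := by exact_mod_cast hn
      have : (((n + 1 : ℕ) : ℝ) ^ 2)⁻¹ ≤ (n : ℝ)⁻¹ - ((n + 1 : ℕ) : ℝ)⁻¹ := by
        push_cast
        rw [inv_sub_inv (by positivity) (by positivity), inv_eq_one_div]
        rw [div_le_div_iff₀ (by positivity) (by positivity)]
        nlinarith
      linarith
  have : (0 : ℝ) ≤ (n : ℝ)⁻¹ := by positivity
  linarith

open Classical in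
/-- The squarefree `k`-smooth numbers up to `y`. -/
noncomputable def squarefreeSmoothUpTo (y k : ℕ) : Finset ℕ :=
  {s ∈ Icc 1 y | Squarefree s ∧ ∀ p, p.Prime → p ∣ s → p < k}

lemma mem_squarefreeSmoothUpTo {y k s : ℕ} : s ∈ squarefreeSmoothUpTo y k ↔
    (1 ≤ s ∧ s ≤ y) ∧ Squarefree s ∧ ∀ p, p.Prime → p ∣ s → p < k := by
  simp [squarefreeSmoothUpTo]

lemma sum_log_div_squarefreeSmooth_le (y : ℕ) {k : ℕ} (hk : 2 ≤ k) :
    ∑ s ∈ squarefreeSmoothUpTo y k, log s * (s : ℝ)⁻¹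
      ≤ 3 * log k * ∑ s ∈ squarefreeSmoothUpTo y k, (s : ℝ)⁻¹ := by
  calc ∑ s ∈ squarefreeSmoothUpTo y k, log s * (s : ℝ)⁻¹
      = ∑ s ∈ squarefreeSmoothUpTo y k, ∑ p ∈ s.primeFactors, log p * (s : ℝ)⁻¹ := by
        refine sum_congr rfl fun s hs => ?_
        rw [← sum_mul, sum_log_primeFactors_of_squarefree (mem_squarefreeSmoothUpTo.1 hs).2.1]
    _ = ∑ x ∈ (squarefreeSmoothUpTo y k).sigma fun s => s.primeFactors,
          log x.2 * (x.1 : ℝ)⁻¹ := by rw [sum_sigma]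
    _ = ∑ x ∈ ((squarefreeSmoothUpTo y k).sigma fun s => s.primeFactors).image
          fun x => ((x.2, x.1 / x.2) : ℕ × ℕ), log x.1 / x.1 * (x.2 : ℝ)⁻¹ := by
        rw [sum_image]
        · refine sum_congr rfl fun x hx => ?_
          simp only [mem_sigma, Nat.mem_primeFactors] at hx
          have : (x.2 : ℝ) ≠ 0 := by exact_mod_cast hx.2.1.ne_zero
          rw [Nat.cast_div hx.2.2.1 this]
          have : (x.1 : ℝ) ≠ 0 := by exact_mod_cast hx.2.2.2
          field_simp
        · rintro ⟨s, p⟩ hx ⟨s', p'⟩ hx' h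
          simp only [mem_coe, mem_sigma, Nat.mem_primeFactors] at hx hx'
          simp only [Prod.mk.injEq] at h
          obtain ⟨rfl, h⟩ := h
          rw [Nat.div_left_inj hx.2.2.1 hx'.2.2.1] at h
          rw [h]
    _ ≤ ∑ x ∈ k.primesLE ×ˢ squarefreeSmoothUpTo y k, log x.1 / x.1 * (x.2 : ℝ)⁻¹ := by
        refine sum_le_sum_of_subset_of_nonneg ?_ fun x _ _ => ?_
        · intro x hx
          simp only [mem_image, mem_sigma, Nat.mem_primeFactors, mem_squarefreeSmoothUpTo] at hx
          obtain ⟨⟨s, p⟩, ⟨⟨⟨hs1, hsy⟩, hsq, hsm⟩, hp, hd, -⟩, rfl⟩ := hx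
          have hds : s / p ∣ s := Nat.div_dvd_of_dvd hd
          simp only [mem_product, Nat.mem_primesLE, mem_squarefreeSmoothUpTo]
          exact ⟨⟨(hsm p hp hd).le, hp⟩, ⟨Nat.div_pos (Nat.le_of_dvd hs1 hd) hp.pos,
            (Nat.div_le_self _ _).trans hsy⟩, hsq.squarefree_of_dvd hds,
            fun q hq hqd => hsm q hq (hqd.trans hds)⟩
        · have := log_natCast_nonneg x.1
          positivity
    _ = (∑ p ∈ k.primesLE, log p / p) * ∑ s ∈ squarefreeSmoothUpTo y k, (s : ℝ)⁻¹ := by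
        rw [sum_mul_sum, sum_product]
    _ ≤ _ := by
        have h0 : 0 ≤ ∑ s ∈ squarefreeSmoothUpTo y k, (s : ℝ)⁻¹ :=
          sum_nonneg fun _ _ => by positivity
        refine mul_le_mul_of_nonneg_right ?_ h0
        linarith [sum_log_div_prime_le (n := k) (by omega), log_four_le hk]

lemma sum_inv_squarefreeSmooth_le (y : ℕ) {k : ℕ} (hk : 2 ≤ k) :
    ∑ s ∈ squarefreeSmoothUpTo y k, (s : ℝ)⁻¹ ≤ 16 * log k := by
  have hlog := half_lt_log hk
  have hk0 : (0 : ℝ) < k := by exact_mod_cast (by omega : 0 < k)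
  have hsmall : ∑ s ∈ squarefreeSmoothUpTo y k with s ≤ k ^ 6, (s : ℝ)⁻¹ ≤ 1 + 6 * log k := by
    calc _ ≤ ∑ i ∈ Icc 1 (k ^ 6), (i : ℝ)⁻¹ := by
          refine sum_le_sum_of_subset_of_nonneg ?_ fun x _ _ => by positivity
          intro s hs
          rw [mem_filter, mem_squarefreeSmoothUpTo] at hs
          exact mem_Icc.2 ⟨hs.1.1.1, hs.2⟩
      _ ≤ 1 + log ((k ^ 6 : ℕ) : ℝ) := sum_inv_Icc_le _
      _ = _ := by push_cast; rw [log_pow]; norm_num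
  have hlarge : 6 * log k * ∑ s ∈ squarefreeSmoothUpTo y k with ¬ s ≤ k ^ 6, (s : ℝ)⁻¹
      ≤ 3 * log k * ∑ s ∈ squarefreeSmoothUpTo y k, (s : ℝ)⁻¹ := by
    refine le_trans ?_ (sum_log_div_squarefreeSmooth_le y hk)
    rw [mul_sum]
    calc _ ≤ ∑ s ∈ squarefreeSmoothUpTo y k with ¬ s ≤ k ^ 6, log s * (s : ℝ)⁻¹ := by
          refine sum_le_sum fun s hs => ?_
          rw [mem_filter, not_le] at hs
          have : log ((k : ℝ) ^ 6) ≤ log s :=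
            log_le_log (by positivity) (by exact_mod_cast hs.2.le)
          rw [log_pow] at this
          push_cast at this
          gcongr
      _ ≤ _ := by
          refine sum_le_sum_of_subset_of_nonneg (filter_subset _ _) fun s _ _ => ?_
          have := log_natCast_nonneg s
          positivity
  have hsplit := sum_filter_add_sum_filter_not (squarefreeSmoothUpTo y k) (· ≤ k ^ 6)
    fun s => (s : ℝ)⁻¹
  rw [← hsplit] at hlarge ⊢
  set A := ∑ s ∈ squarefreeSmoothUpTo y k with s ≤ k ^ 6, (s : ℝ)⁻¹
  set B := ∑ s ∈ squarefreeSmoothUpTo y k with ¬ s ≤ k ^ 6, (s : ℝ)⁻¹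
  have hBA : B ≤ A := by
    refine le_of_mul_le_mul_left (a := 3 * log k) ?_ (by linarith)
    linarith
  linarith

open Classical in
/-- The positive integers up to `y` without prime factors below `k`. -/
noncomputable def roughUpTo (y k : ℕ) : Finset ℕ :=
  {s ∈ Icc 1 y | ∀ p, p.Prime → p ∣ s → k ≤ p}

lemma mem_roughUpTo {y k s : ℕ} : s ∈ roughUpTo y k ↔
    (1 ≤ s ∧ s ≤ y) ∧ ∀ p, p.Prime → p ∣ s → k ≤ p := by
  simp [roughUpTo]

lemma exists_smooth_mul_rough (k : ℕ) {n : ℕ} (hn : n ≠ 0) :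
    ∃ s m, s * m = n ∧ (∀ p, p.Prime → p ∣ s → p < k) ∧ ∀ p, p.Prime → p ∣ m → k ≤ p := by
  induction n using Nat.recOnMul with
  | zero => exact absurd rfl hn
  | one => exact ⟨1, 1, rfl, fun p hp h => absurd (Nat.dvd_one.1 h) hp.ne_one,
      fun p hp h => absurd (Nat.dvd_one.1 h) hp.ne_one⟩
  | prime q hq =>
    by_cases h : q < k
    · exact ⟨q, 1, mul_one q, fun p hp hd => by rwa [(Nat.prime_dvd_prime_iff_eq hp hq).1 hd],
        fun p hp h => absurd (Nat.dvd_one.1 h) hp.ne_one⟩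
    · exact ⟨1, q, one_mul q, fun p hp h => absurd (Nat.dvd_one.1 h) hp.ne_one,
        fun p hp hd => by rw [(Nat.prime_dvd_prime_iff_eq hp hq).1 hd]; omega⟩
  | mul a b iha ihb =>
    obtain ⟨s, m, rfl, hs, hm⟩ := iha (left_ne_zero_of_mul hn)
    obtain ⟨s', m', rfl, hs', hm'⟩ := ihb (right_ne_zero_of_mul hn)
    exact ⟨s * s', m * m', by ring,
      fun p hp hd => ((Nat.Prime.dvd_mul hp).1 hd).elim (hs p hp) (hs' p hp),
      fun p hp hd => ((Nat.Prime.dvd_mul hp).1 hd).elim (hm p hp) (hm' p hp)⟩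

lemma exists_sq_mul_squarefreeSmooth_mul_rough {y n : ℕ} (k : ℕ) (hn : n ∈ Icc 1 y) :
    ∃ x ∈ Icc 1 y ×ˢ squarefreeSmoothUpTo y k ×ˢ roughUpTo y k,
      x.1 ^ 2 * x.2.1 * x.2.2 = n := by
  rw [mem_Icc] at hn
  obtain ⟨s, m, rfl, hs, hm⟩ := exists_smooth_mul_rough k (by omega : n ≠ 0)
  obtain ⟨a, q, rfl, ha⟩ := Nat.sq_mul_squarefree s
  have hpos : 0 < q ^ 2 * a * m := hn.1
  have h1 : q ∣ q ^ 2 * a * m := ⟨q * a * m, by ring⟩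
  have h2 : a ∣ q ^ 2 * a * m := ⟨q ^ 2 * m, by ring⟩
  have h3 : m ∣ q ^ 2 * a * m := ⟨q ^ 2 * a, by ring⟩
  refine ⟨(q, a, m), ?_, rfl⟩
  simp only [mem_product, mem_Icc, mem_squarefreeSmoothUpTo, mem_roughUpTo]
  exact ⟨⟨Nat.pos_of_dvd_of_pos h1 hpos, (Nat.le_of_dvd hpos h1).trans hn.2⟩,
    ⟨⟨Nat.pos_of_dvd_of_pos h2 hpos, (Nat.le_of_dvd hpos h2).trans hn.2⟩, ha,
      fun p hp hd => hs p hp (hd.mul_left _)⟩,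
    ⟨Nat.pos_of_dvd_of_pos h3 hpos, (Nat.le_of_dvd hpos h3).trans hn.2⟩, hm⟩

lemma log_add_one_le_sum_inv_rough (y : ℕ) {k : ℕ} (hk : 2 ≤ k) :
    log (y + 1) ≤ 32 * log k * ∑ m ∈ roughUpTo y k, (m : ℝ)⁻¹ := by
  choose! f hf hfn using fun n (hn : n ∈ Icc 1 y) =>
    exists_sq_mul_squarefreeSmooth_mul_rough k hn
  have hR : 0 ≤ ∑ m ∈ roughUpTo y k, (m : ℝ)⁻¹ := sum_nonneg fun _ _ => by positivity
  calc log (y + 1) ≤ ∑ n ∈ Icc 1 y, (n : ℝ)⁻¹ := log_add_one_le_sum_inv_Icc y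
    _ = ∑ n ∈ Icc 1 y, (((f n).1 : ℝ) ^ 2)⁻¹ * (((f n).2.1 : ℝ)⁻¹ * ((f n).2.2 : ℝ)⁻¹) := by
        refine sum_congr rfl fun n hn => ?_
        conv_lhs => rw [← hfn n hn]
        push_cast
        rw [mul_inv, mul_inv, mul_assoc]
    _ = ∑ x ∈ (Icc 1 y).image f, ((x.1 : ℝ) ^ 2)⁻¹ * ((x.2.1 : ℝ)⁻¹ * (x.2.2 : ℝ)⁻¹) := by
        rw [sum_image]
        intro a ha b hb hab
        rw [← hfn a ha, ← hfn b hb, hab]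
    _ ≤ ∑ x ∈ Icc 1 y ×ˢ squarefreeSmoothUpTo y k ×ˢ roughUpTo y k,
          ((x.1 : ℝ) ^ 2)⁻¹ * ((x.2.1 : ℝ)⁻¹ * (x.2.2 : ℝ)⁻¹) := by
        refine sum_le_sum_of_subset_of_nonneg (image_subset_iff.2 hf) fun _ _ _ => ?_
        positivity
    _ = (∑ q ∈ Icc 1 y, ((q : ℝ) ^ 2)⁻¹) *
          ((∑ s ∈ squarefreeSmoothUpTo y k, (s : ℝ)⁻¹) * ∑ m ∈ roughUpTo y k, (m : ℝ)⁻¹) := by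
        rw [sum_mul_sum, ← sum_product', sum_mul_sum, ← sum_product']
    _ ≤ 2 * (16 * log k * ∑ m ∈ roughUpTo y k, (m : ℝ)⁻¹) := by
        have := sum_inv_squarefreeSmooth_le y hk
        have := sum_inv_sq_Icc_le y
        gcongr
    _ = _ := by ring

lemma half_le_theta {x : ℝ} (hx : 50 ^ 4 ≤ x) : x / 2 ≤ θ x := by
  have hx1 : 1 ≤ x := le_trans (by norm_num) hx
  have h := theta_ge' hx1
  obtain ⟨u, hu, rfl⟩ : ∃ u : ℝ, 50 ≤ u ∧ u ^ 4 = x :=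
    ⟨x ^ (1 / 4 : ℝ), by
      calc (50 : ℝ) = ((50 : ℝ) ^ 4) ^ (1 / 4 : ℝ) := by
            rw [← rpow_natCast, ← rpow_mul (by norm_num)]; norm_num
        _ ≤ _ := by gcongr,
      by rw [← rpow_natCast, ← rpow_mul (by linarith)]; norm_num⟩
  have hsqrt : √(u ^ 4) = u ^ 2 := by
    rw [show u ^ 4 = (u ^ 2) ^ 2 by ring, sqrt_sq (by positivity)]
  have hlogu : log u ≤ u := (log_le_sub_one_of_pos (by linarith)).trans (by linarith)
  have hlog : log (u ^ 4) ≤ 4 * u := by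
    rw [log_pow]; push_cast; linarith
  have hlog2 : log (u ^ 4 + 2) ≤ 2 + 4 * u := by
    have h3 : log (3 : ℝ) ≤ 2 := (log_le_sub_one_of_pos (by norm_num)).trans (by norm_num)
    calc log (u ^ 4 + 2) ≤ log (3 * u ^ 4) := log_le_log (by positivity) (by linarith)
      _ = log 3 + log (u ^ 4) := log_mul (by norm_num) (by positivity)
      _ ≤ _ := by linarith
  rw [hsqrt] at h
  have h1 : 2 * u ^ 2 * log (u ^ 4) ≤ 2 * u ^ 2 * (4 * u) := by gcongr
  have h2 : (u ^ 4 - 1) * 0.69 ≤ (u ^ 4 - 1) * log 2 := by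
    have := log_two_gt_d9
    have : (0 : ℝ) ≤ u ^ 4 - 1 := by linarith
    gcongr
    linarith
  have h3 : 50 * u ^ 3 ≤ u ^ 4 := by nlinarith [pow_nonneg (by linarith : (0 : ℝ) ≤ u) 3]
  have h4 : 2500 * u ≤ u ^ 3 := by
    nlinarith [mul_nonneg (by linarith : (0 : ℝ) ≤ u - 50) (by linarith : (0 : ℝ) ≤ u + 50)]
  nlinarith

lemma div_four_le_sum_log_primes {x : ℝ} {k : ℕ} (hx : 50 ^ 4 ≤ x) (hk : 6 * k ≤ x) :
    x / 4 ≤ ∑ p ∈ ⌊x⌋₊.primesLE with k ≤ p, log p := by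
  have h1 : θ x = ∑ p ∈ ⌊x⌋₊.primesLE, log p := by
    rw [theta_eq_theta_coe_floor, theta_eq_sum_primesLE_log]
  have h2 : ∑ p ∈ ⌊x⌋₊.primesLE with ¬ k ≤ p, log (p : ℝ) ≤ θ k := by
    rw [theta_eq_sum_primesLE_log]
    refine sum_le_sum_of_subset_of_nonneg ?_ fun p _ _ => log_natCast_nonneg p
    intro p hp
    rw [mem_filter, Nat.mem_primesLE] at hp
    exact Nat.mem_primesLE.2 ⟨by omega, hp.1.2⟩
  have h3 := theta_le_log4_mul_x (x := k) (by positivity)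
  have h4 : log 4 * (k : ℝ) ≤ 1.5 * k := by
    have : log (4 : ℝ) = 2 * log 2 := by
      rw [show (4 : ℝ) = 2 ^ 2 by norm_num, log_pow]; norm_num
    have := log_two_lt_d9
    gcongr
    linarith
  have h5 := sum_filter_add_sum_filter_not ⌊x⌋₊.primesLE (k ≤ ·) fun p => log (p : ℝ)
  linarith [half_le_theta hx]

lemma sum_rough_sum_log_primes_le (N y k : ℕ) :
    ∑ m ∈ roughUpTo y k, ∑ p ∈ (N / m).primesLE with k ≤ p, log (p : ℝ)
      ≤ #(roughUpTo N k) * log N := by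
  calc _ = ∑ x ∈ (roughUpTo y k).sigma fun m => {p ∈ (N / m).primesLE | k ≤ p},
          log (x.2 : ℝ) := by rw [sum_sigma]
    _ = ∑ x ∈ ((roughUpTo y k).sigma fun m => {p ∈ (N / m).primesLE | k ≤ p}).image
          fun x => (⟨x.1 * x.2, x.2⟩ : (_ : ℕ) × ℕ), log (x.2 : ℝ) := by
        rw [sum_image]
        rintro ⟨m, p⟩ hx ⟨m', p'⟩ hx' h
        simp only [mem_coe, mem_sigma, mem_filter, Nat.mem_primesLE] at hx hx'
        simp only [Sigma.mk.injEq, heq_eq_eq] at h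
        obtain ⟨h, rfl⟩ := h
        rw [Nat.eq_of_mul_eq_mul_right hx.2.1.2.pos h]
    _ ≤ ∑ x ∈ (roughUpTo N k).sigma fun n => n.primeFactors, log (x.2 : ℝ) := by
        refine sum_le_sum_of_subset_of_nonneg ?_ fun x _ _ => log_natCast_nonneg x.2
        intro x hx
        simp only [mem_image, mem_sigma, mem_filter, Nat.mem_primesLE, mem_roughUpTo] at hx
        obtain ⟨⟨m, p⟩, ⟨⟨⟨hm1, hmy⟩, hm⟩, ⟨hpN, hp⟩, hkp⟩, rfl⟩ := hx
        simp only [mem_sigma, Nat.mem_primeFactors, mem_roughUpTo]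
        have hpos : 0 < m * p := Nat.mul_pos hm1 hp.pos
        refine ⟨⟨⟨hpos, ?_⟩, fun q hq hd => ?_⟩, hp, dvd_mul_left _ _, hpos.ne'⟩
        · rw [mul_comm]; exact (Nat.le_div_iff_mul_le hm1).1 hpN
        · rcases (Nat.Prime.dvd_mul hq).1 hd with h | h
          · exact hm q hq h
          · rwa [(Nat.prime_dvd_prime_iff_eq hq hp).1 h]
    _ = ∑ n ∈ roughUpTo N k, ∑ p ∈ n.primeFactors, log (p : ℝ) := by rw [sum_sigma]
    _ ≤ ∑ _n ∈ roughUpTo N k, log N := by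
        refine sum_le_sum fun n hn => ?_
        have hn := (mem_roughUpTo.1 hn).1
        exact (sum_log_primeFactors_le (by omega)).trans
          (log_le_log (by exact_mod_cast hn.1) (by exact_mod_cast hn.2))
    _ = _ := by simp

lemma div_log_le_card_rough_of_pow_le {N k : ℕ} (hk : 2 ≤ k) (hN : 50 ^ 8 ≤ N)
    (hkN : k ^ 8 ≤ N) : N / (256 * log k) ≤ #(roughUpTo N k) := by
  have hlogk := half_lt_log hk
  set y := N.sqrt with hy
  have hy1 : 50 ^ 4 ≤ y := Nat.le_sqrt'.2 (by rw [← pow_mul]; exact hN)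
  have hy2 : k ^ 4 ≤ y := Nat.le_sqrt'.2 (by rw [← pow_mul]; exact hkN)
  have hy3 : 6 * k ≤ y := by
    have : 2 ^ 3 * k ≤ k ^ 3 * k := by gcongr
    have : k ^ 3 * k = k ^ 4 := by ring
    omega
  have hN1 : 1 < N := lt_of_lt_of_le (by norm_num) hN
  have hlogN : 0 < log (N : ℝ) := log_pos (by exact_mod_cast hN1)
  have hlogy : log N ≤ 2 * log (y + 1) := by
    have : (N : ℝ) ≤ (y + 1) ^ 2 := by exact_mod_cast (Nat.lt_succ_sqrt' N).le
    calc log (N : ℝ) ≤ log (((y : ℝ) + 1) ^ 2) := log_le_log (by exact_mod_cast (by omega)) this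
      _ = _ := by rw [log_pow]; norm_num
  have hR := log_add_one_le_sum_inv_rough y hk
  have hlow : N / 4 * ∑ m ∈ roughUpTo y k, (m : ℝ)⁻¹ ≤ #(roughUpTo N k) * log N := by
    refine le_trans ?_ (sum_rough_sum_log_primes_le N y k)
    rw [mul_sum]
    refine sum_le_sum fun m hm => ?_
    have hm := (mem_roughUpTo.1 hm).1
    have hm0 : (0 : ℝ) < m := by exact_mod_cast hm.1
    have hyN : (y : ℝ) ≤ N / m := by
      rw [le_div_iff₀ hm0]
      exact_mod_cast (Nat.mul_le_mul_left y hm.2).trans (Nat.sqrt_le N)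
    have := div_four_le_sum_log_primes (x := N / m) (k := k)
      (le_trans (by exact_mod_cast hy1) hyN) (le_trans (by exact_mod_cast hy3) hyN)
    rw [Nat.floor_div_eq_div] at this
    calc (N : ℝ) / 4 * (m : ℝ)⁻¹ = N / m / 4 := by ring
      _ ≤ _ := this
  rw [div_le_iff₀ (by positivity)]
  refine le_of_mul_le_mul_right ?_ hlogN
  set R := ∑ m ∈ roughUpTo y k, (m : ℝ)⁻¹
  calc (N : ℝ) * log N ≤ N * (64 * log k * R) := by gcongr; linarith
    _ = 256 * log k * (N / 4 * R) := by ring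
    _ ≤ 256 * log k * (#(roughUpTo N k) * log N) := by gcongr
    _ = _ := by ring

lemma div_log_le_card_rough_of_lt_pow {N k : ℕ} (hk : 2 ≤ k) (hN : 50 ^ 8 ≤ N)
    (hkN : N < k ^ 8) (hNk : 32 * k * log k ≤ N) :
    N / (256 * log k) ≤ #(roughUpTo N k) := by
  have hlogk := half_lt_log hk
  have hN1 : 1 < N := lt_of_lt_of_le (by norm_num) hN
  have hlogN : log (N : ℝ) ≤ 8 * log k := by
    calc log (N : ℝ) ≤ log ((k : ℝ) ^ 8) :=
          log_le_log (by exact_mod_cast (by omega)) (by exact_mod_cast hkN.le)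
      _ = _ := by rw [log_pow]; norm_num
  have h50 : (50 ^ 4 : ℝ) ≤ N := by
    have : (50 ^ 8 : ℝ) ≤ N := by exact_mod_cast hN
    linarith
  have h6 : (6 * k : ℝ) ≤ N := by nlinarith [(Nat.cast_nonneg k : (0 : ℝ) ≤ k)]
  have hsum := div_four_le_sum_log_primes h50 h6
  rw [Nat.floor_natCast] at hsum
  have hcard : ∑ p ∈ N.primesLE with k ≤ p, log (p : ℝ) ≤ #(roughUpTo N k) * log N := by
    calc _ ≤ ∑ p ∈ roughUpTo N k, log (p : ℝ) := by
          refine sum_le_sum_of_subset_of_nonneg ?_ fun p _ _ => log_natCast_nonneg p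
          intro p hp
          rw [mem_filter, Nat.mem_primesLE] at hp
          refine mem_roughUpTo.2 ⟨⟨hp.1.2.pos, hp.1.1⟩, fun q hq hd => ?_⟩
          rw [(Nat.prime_dvd_prime_iff_eq hq hp.1.2).1 hd]
          exact hp.2
      _ ≤ ∑ _p ∈ roughUpTo N k, log N := by
          refine sum_le_sum fun n hn => ?_
          have hn := (mem_roughUpTo.1 hn).1
          exact log_le_log (by exact_mod_cast hn.1) (by exact_mod_cast hn.2)
      _ = _ := by simp
  rw [div_le_iff₀ (by positivity)]
  have : (#(roughUpTo N k) : ℝ) * log N ≤ #(roughUpTo N k) * (8 * log k) := by gcongr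
  nlinarith [mul_nonneg (Nat.cast_nonneg #(roughUpTo N k) : (0 : ℝ) ≤ _)
    (by linarith : 0 ≤ log (k : ℝ))]

/-- A lower bound of the expected order for the number of integers up to `N` without prime
factors below `k`. -/
lemma div_log_le_card_rough {N k : ℕ} (hk : 2 ≤ k) (hN : 50 ^ 8 ≤ N)
    (hNk : 32 * k * log k ≤ N) : N / (256 * log k) ≤ #(roughUpTo N k) := by
  rcases le_or_gt (k ^ 8) N with h | h
  · exact div_log_le_card_rough_of_pow_le hk hN h
  · exact div_log_le_card_rough_of_lt_pow hk hN h hNk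

/-- A number has at most one factorization into a number below `k` and a `k`-rough number. -/
lemma eq_of_mul_rough_eq_mul_rough {k i j d e : ℕ} (hi : 0 < i) (hik : i < k) (hj : 0 < j)
    (hjk : j < k) (hd : ∀ p, p.Prime → p ∣ d → k ≤ p) (he : ∀ p, p.Prime → p ∣ e → k ≤ p)
    (h : i * d = j * e) : d = e := by
  have coprime : ∀ {a b : ℕ}, 0 < a → a < k → (∀ p, p.Prime → p ∣ b → k ≤ p) →
      Nat.Coprime a b := fun {a b} ha hak hb =>
    Nat.Coprime.symm <| Nat.coprime_of_dvd fun p hp hpb hpa =>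
      absurd (hb p hp hpb) (by have := Nat.le_of_dvd ha hpa; omega)
  have h1 : i ∣ j := (coprime hi hik he).dvd_of_dvd_mul_right (Dvd.intro d h)
  have h2 : j ∣ i := (coprime hj hjk hd).dvd_of_dvd_mul_right (Dvd.intro e h.symm)
  obtain rfl := Nat.dvd_antisymm h1 h2
  exact Nat.eq_of_mul_eq_mul_left hi h

/-- If no progression with start at most `M` and `k`-rough difference at most `N` is rainbow,
then these progressions inject into the triples of two points of equal color and a position. -/
lemma card_mul_card_rough_le {α : Type*} [DecidableEq α] {n k M N : ℕ} (χ : ℕ → α)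
    (hMN : M + (k - 1) * N ≤ n)
    (h : ∀ a d, 1 ≤ a → 1 ≤ d → a + (k - 1) * d ≤ n →
      ∃ i < k, ∃ j < k, i ≠ j ∧ χ (a + i * d) = χ (a + j * d)) :
    M * #(roughUpTo N k) ≤
      #((Icc 1 n).sigma fun x => {y ∈ Icc 1 n | χ y = χ x}) * k := by
  have h' : ∀ z ∈ Icc 1 M ×ˢ roughUpTo N k, ∃ i j, i < j ∧ j < k ∧
      z.1 + j * z.2 ≤ n ∧ χ (z.1 + i * z.2) = χ (z.1 + j * z.2) := by
    intro z hz
    rw [mem_product, mem_Icc, mem_roughUpTo] at hz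
    have hz1 : z.1 + (k - 1) * z.2 ≤ n :=
      (Nat.add_le_add hz.1.2 (Nat.mul_le_mul_left _ hz.2.1.2)).trans hMN
    have hle : ∀ j < k, z.1 + j * z.2 ≤ n := fun j hj =>
      (Nat.add_le_add_left (Nat.mul_le_mul_right _ (by omega)) _).trans hz1
    obtain ⟨i, hi, j, hj, hij, hχ⟩ := h z.1 z.2 hz.1.1 hz.2.1.1 hz1
    rcases lt_or_gt_of_ne hij with hlt | hlt
    · exact ⟨i, j, hlt, hj, hle j hj, hχ⟩
    · exact ⟨j, i, hlt, hi, hle i hi, hχ.symm⟩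
  choose! i j hij hj hn hχ using h'
  have hcard : M * #(roughUpTo N k) = #(Icc 1 M ×ˢ roughUpTo N k) := by simp
  have hcard' : #((Icc 1 n).sigma fun x => {y ∈ Icc 1 n | χ y = χ x}) * k =
      #(((Icc 1 n).sigma fun x => {y ∈ Icc 1 n | χ y = χ x}) ×ˢ range k) := by simp
  rw [hcard, hcard']
  refine card_le_card_of_injOn
    (fun z => (⟨z.1 + i z * z.2, z.1 + j z * z.2⟩, i z)) ?_ ?_
  · intro z hz
    have h1 := hij z hz
    have h2 := hj z hz
    have h3 := hn z hz
    have h4 := Nat.mul_le_mul_right z.2 h1.le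
    have hz' := hz
    simp only [coe_product, Set.mem_prod, mem_coe, mem_Icc] at hz'
    simp only [mem_coe, mem_product, mem_sigma, mem_filter, mem_Icc, mem_range]
    exact ⟨⟨⟨by omega, by omega⟩, ⟨by omega, by omega⟩, (hχ z hz).symm⟩, by omega⟩
  · intro z hz w hw heq
    have hz1 := hij z hz
    have hz2 := hj z hz
    have hw1 := hij w hw
    have hw2 := hj w hw
    have hzr := (mem_roughUpTo.1 (mem_product.1 hz).2).2
    have hwr := (mem_roughUpTo.1 (mem_product.1 hw).2).2
    simp only [Prod.mk.injEq, Sigma.mk.injEq, heq_eq_eq] at heq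
    obtain ⟨⟨h1, h2⟩, h3⟩ := heq
    have h4 : (j z - i z) * z.2 = (j w - i w) * w.2 := by
      rw [Nat.sub_mul, Nat.sub_mul]
      omega
    have h5 := eq_of_mul_rough_eq_mul_rough (by omega) (by omega) (by omega) (by omega) hzr hwr h4
    rw [h3, h5] at h1
    exact Prod.ext (by omega) h5

end RainbowAP

open RainbowAP in
/-- There is a constant `c > 0` such that for every `k ≥ 2`, every `t ≥ c k² log k` and
every `m ≥ 1`, every coloring of `{1, …, tm}` with `t` colors in which every color is used
exactly `m` times contains a rainbow `k`-term arithmetic progression; that is,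
`T_k ≤ c k² log k`. -/
theorem equinumerous_rainbow_ap :
    ∃ c : ℝ, 0 < c ∧
      ∀ k : ℕ, 2 ≤ k → ∀ t : ℕ, c * k ^ 2 * Real.log k ≤ (t : ℝ) →
        ∀ m : ℕ, 0 < m →
          ∀ χ : ℕ → Fin t,
            (∀ col : Fin t, {i : ℕ | i ∈ Finset.Icc 1 (t * m) ∧ χ i = col}.ncard = m) →
            ∃ a d : ℕ, 1 ≤ a ∧ 1 ≤ d ∧ a + (k - 1) * d ≤ t * m ∧
              ∀ i < k, ∀ j < k, i ≠ j → χ (a + i * d) ≠ χ (a + j * d) := by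
  refine ⟨10 * 50 ^ 8, by positivity, fun k hk t ht m hm χ hχ => ?_⟩
  by_contra! hcon
  have hlogk := half_lt_log hk
  have hk2 : (2 : ℝ) ≤ k := by exact_mod_cast hk
  have hm1 : (1 : ℝ) ≤ m := by exact_mod_cast hm
  have htm : (t : ℝ) ≤ t * m := le_mul_of_one_le_right (by positivity) hm1
  have hL : (1 : ℝ) ≤ k * Real.log k := by nlinarith
  have ht' : 10 * 50 ^ 8 * (k * (k * Real.log k)) ≤ (t : ℝ) := le_trans (le_of_eq (by ring)) ht
  have hkk : (k : ℝ) ≤ k * (k * Real.log k) := le_mul_of_one_le_right (by positivity) hL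
  set n := t * m with hn
  have hnR : (n : ℝ) = t * m := by rw [hn]; push_cast; ring
  set N := n / (2 * k) with hN
  have hNk : (n : ℝ) ≤ 4 * k * N := by
    have h1 : n < 2 * k * (N + 1) := Nat.lt_mul_div_succ n (by omega)
    have h2 : (n : ℝ) < 2 * k * (N + 1) := by exact_mod_cast h1
    nlinarith
  have hNL : 2 * 50 ^ 8 * (k * Real.log k) ≤ N := by
    refine le_of_mul_le_mul_left (a := 4 * (k : ℝ)) ?_ (by positivity)
    nlinarith
  have hrough := div_log_le_card_rough (N := N) hk
    (by exact_mod_cast (by linarith : (50 ^ 8 : ℝ) ≤ N)) (by linarith)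
  have hMN : n / 2 + (k - 1) * N ≤ n := by
    have h1 : 2 * (k * N) ≤ n := by
      rw [← mul_assoc]; exact Nat.mul_div_le n (2 * k)
    have h2 : (k - 1) * N ≤ k * N := Nat.mul_le_mul_right _ (by omega)
    omega
  have hcount := card_mul_card_rough_le χ hMN hcon
  have hpairs : Finset.card ((Finset.Icc 1 n).sigma fun x =>
      {y ∈ Finset.Icc 1 n | χ y = χ x}) = n * m := by
    rw [Finset.card_sigma, Finset.sum_congr rfl fun x _ => ?_, Finset.sum_const, Nat.card_Icc,
      smul_eq_mul, Nat.add_sub_cancel]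
    rw [← hχ (χ x), ← Set.ncard_coe_finset]
    congr 1
    ext y
    simp
  rw [hpairs] at hcount
  have hn0 : 0 < (n : ℝ) := by nlinarith
  have hhalf : (n : ℝ) ≤ 3 * (n / 2 : ℕ) := by
    have : 2 ≤ n := by
      have : (2 : ℝ) ≤ n := by linarith
      exact_mod_cast this
    exact_mod_cast (by omega : n ≤ 3 * (n / 2))
  set Φ := Finset.card (roughUpTo N k)
  have hcount' : ((n / 2 : ℕ) : ℝ) * Φ ≤ n * m * k := by exact_mod_cast hcount
  have hΦ : (Φ : ℝ) ≤ 3 * m * k := by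
    refine le_of_mul_le_mul_left (a := (n : ℝ)) ?_ hn0
    nlinarith [(Nat.cast_nonneg Φ : (0 : ℝ) ≤ Φ)]
  rw [div_le_iff₀ (by positivity)] at hrough
  have h1 : (t : ℝ) * m ≤ 3072 * (k * (k * Real.log k)) * m := by
    calc (t : ℝ) * m = n := hnR.symm
      _ ≤ 4 * k * N := hNk
      _ ≤ 4 * k * (3 * m * k * (256 * Real.log k)) := by
        gcongr
        refine hrough.trans ?_
        gcongr
      _ = _ := by ring
  have h2 := le_of_mul_le_mul_right h1 (by linarith)
  nlinarith
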